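/- arXiv:1908.11419 — 2 statements merged into one kernel-verified Lean document; each statement's English description precedes it below -/
import Mathlib

section
/- Let W be a symmetric and singular discrete memoryless channel with no all-zero columns, and define α_y = Σ_{x∈X : W(y|x)>0} |X|^{−1} for y ∈ Y and, for r ∈ ℝ⁺, S(r) = { y^N ∈ Y^N : (1/N) Σ_{n=1}^N ln(1/α_{y_n}) ≤ r }. Fix any x_o ∈ X and let x_o^N be the N-tuple with all entries x_o. Then for every collection of maps ψ₁ ∈ X and ψ_n : Y^{n−1} → X (n = 2,…,N) and every r ∈ ℝ⁺, Σ_{y^N ∈ S(r)} W(y₁|ψ₁) Π_{n=2}^N W(y_n|ψ_n(y^{n−1})) = W^N(S(r) | x_o^N); in particular this common value does not depend on the choice of x_o. -/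
open Real Finset

/-- A discrete memoryless channel: `W x y` is the probability of output `y` given input `x`. -/
def IsDMC {X Y : Type} [Fintype X] [Fintype Y] (W : X → Y → ℝ) : Prop :=
  (∀ x y, 0 ≤ W x y) ∧ ∀ x, ∑ y, W x y = 1

/-- Gallager symmetry: the output alphabet can be partitioned into classes such that within
each class every row is a permutation of every other row, and every column is a permutation
of every other column. -/
def GallagerSymmetric {X Y : Type} [Fintype X] [Fintype Y] (W : X → Y → ℝ) : Prop :=
  ∃ cls : Y → ℕ,
    (∀ (l : ℕ) (x x' : X),
        ((Finset.univ.filter fun y => cls y = l).val.map fun y => W x y) =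
        ((Finset.univ.filter fun y => cls y = l).val.map fun y => W x' y)) ∧
    (∀ y y' : Y, cls y = cls y' →
        (Finset.univ.val.map fun x => W x y) = (Finset.univ.val.map fun x => W x y'))

/-- Singularity: whenever two inputs both give an output positive probability,
they give it the same probability. -/
def Singular {X Y : Type} [Fintype X] [Fintype Y] (W : X → Y → ℝ) : Prop :=
  ∀ x z y, 0 < W x y * W z y → W x y = W z y

variable {X Y : Type} [Fintype X] [Fintype Y]

/-- `α_y = Σ_{x : W(y|x) > 0} |X|⁻¹`. -/
noncomputable def alphaU (W : X → Y → ℝ) (y : Y) : ℝ :=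
  ∑ x ∈ Finset.univ.filter (fun x => 0 < W x y), (Fintype.card X : ℝ)⁻¹

/-- `S(r) = { y^N : (1/N) Σ_n ln (1/α_{y_n}) ≤ r }`, as a finset of output words. -/
noncomputable def Sset (W : X → Y → ℝ) (N : ℕ) (r : ℝ) : Finset (Fin N → Y) :=
  Finset.univ.filter fun y : Fin N → Y =>
    (N : ℝ)⁻¹ * ∑ n, Real.log (alphaU W (y n))⁻¹ ≤ r

/-- A map `(Fin N → Y) → Fin N → X` is causal when its value at time `n` depends only on
the outputs at times `< n`; this encodes the data `ψ₁ ∈ X`, `ψ_n : Y^{n-1} → X`. -/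
def CausalMap {N : ℕ} (ψ : (Fin N → Y) → Fin N → X) : Prop :=
  ∀ y y' n, (∀ k, k < n → y k = y' k) → ψ y n = ψ y' n

lemma alphaU_eq_of_map_eq (W : X → Y → ℝ) {y y' : Y}
    (h : (Finset.univ.val.map fun x => W x y) = (Finset.univ.val.map fun x => W x y')) :
    alphaU W y = alphaU W y' := by
  have key := congrArg
    (fun m => (m.map fun w : ℝ => if 0 < w then (Fintype.card X : ℝ)⁻¹ else 0).sum) h
  simp only [Multiset.map_map] at key
  unfold alphaU
  rw [Finset.sum_filter, Finset.sum_filter]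
  exact key

/-- If `b` is constant on the classes of `cls` and the rows of `W` are permutations of each
other within each class, then the expectation of `b` does not depend on the input. -/
lemma sum_mul_eq_of_row_perm (W : X → Y → ℝ) {cls : Y → ℕ}
    (hrow : ∀ (l : ℕ) (x x' : X),
        ((Finset.univ.filter fun y => cls y = l).val.map fun y => W x y) =
        ((Finset.univ.filter fun y => cls y = l).val.map fun y => W x' y))
    {b : Y → ℝ} (hb : ∀ y y', cls y = cls y' → b y = b y') (x x' : X) :
    ∑ y, W x y * b y = ∑ y, W x' y * b y := by
  have hmaps : ∀ y ∈ (Finset.univ : Finset Y), cls y ∈ Finset.univ.image cls :=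
    fun y _ => Finset.mem_image_of_mem _ (Finset.mem_univ _)
  rw [← Finset.sum_fiberwise_of_maps_to hmaps, ← Finset.sum_fiberwise_of_maps_to hmaps]
  refine Finset.sum_congr rfl fun l hl => ?_
  obtain ⟨y₀, -, rfl⟩ := Finset.mem_image.1 hl
  have factor : ∀ z, ∑ y with cls y = cls y₀, W z y * b y
      = (∑ y with cls y = cls y₀, W z y) * b y₀ := fun z => by
    rw [Finset.sum_mul]
    refine Finset.sum_congr rfl fun y hy => ?_
    rw [hb y y₀ (Finset.mem_filter.1 hy).2]
  rw [factor, factor]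
  exact congrArg (· * b y₀) (congrArg Multiset.sum (hrow (cls y₀) x x'))

/-- Feedback does not change the distribution of an additive statistic whose single-letter
distribution is the same under every input. -/
lemma sum_causal_eq (W : X → Y → ℝ) [Nonempty Y] (a : Y → ℝ)
    (ha : ∀ (G : ℝ → ℝ) (x x' : X), ∑ y, W x y * G (a y) = ∑ y, W x' y * G (a y)) (xo : X) :
    ∀ (N : ℕ) (g : ℝ → ℝ) (ψ : (Fin N → Y) → Fin N → X), CausalMap ψ →
      ∑ y : Fin N → Y, (∏ n, W (ψ y n) (y n)) * g (∑ n, a (y n)) =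
        ∑ y : Fin N → Y, (∏ n, W xo (y n)) * g (∑ n, a (y n)) := by
  intro N
  induction N with
  | zero => intro g ψ _; simp
  | succ N ih =>
    intro g ψ hψ
    obtain ⟨x₀, hx₀⟩ : ∃ x₀, ∀ y, ψ y 0 = x₀ :=
      ⟨ψ (fun _ => Classical.arbitrary Y) 0,
        fun y => hψ _ _ _ fun k hk => absurd hk (Fin.not_lt_zero k)⟩
    have split : ∀ F : (Fin (N + 1) → Y) → ℝ,
        ∑ y, F y = ∑ y₀ : Y, ∑ y : Fin N → Y, F (Fin.cons y₀ y) := fun F => by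
      rw [← (Fin.consEquiv fun _ => Y).sum_comp F, Fintype.sum_prod_type]
      rfl
    rw [split, split]
    simp only [Fin.prod_univ_succ, Fin.sum_univ_succ, Fin.cons_zero, Fin.cons_succ, hx₀,
      mul_assoc, ← Finset.mul_sum]
    rw [← ha (fun t => ∑ y : Fin N → Y, (∏ n, W xo (y n)) * g (t + ∑ n, a (y n))) x₀ xo]
    refine Finset.sum_congr rfl fun y₀ _ => congrArg (W x₀ y₀ * ·) ?_
    refine ih (fun t => g (a y₀ + t)) (fun y n => ψ (Fin.cons y₀ y) n.succ) ?_
    intro y y' n h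
    refine hψ _ _ _ fun k => Fin.cases (fun _ => rfl) (fun k hk => ?_) k
    simpa using h k (Fin.succ_lt_succ_iff.1 hk)

/-- **Lemma (singular-lem1)(i)**: for a symmetric singular channel with no all-zero columns,
for every causal family `ψ` and every `r > 0`,
`Σ_{y^N ∈ S(r)} Π_n W(y_n | ψ_n(y^{n-1})) = W^N(S(r) | x_o^N)`;
in particular the right side does not depend on `x_o`. -/
theorem statement14 {X Y : Type} [Fintype X] [Fintype Y] [Nonempty X] [Nonempty Y]
    (W : X → Y → ℝ) (hW : IsDMC W) (hsym : GallagerSymmetric W) (hsing : Singular W)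
    (hcol : ∀ y, ∃ x, 0 < W x y)
    (N : ℕ) (hN : 0 < N) (ψ : (Fin N → Y) → Fin N → X) (hψ : CausalMap ψ)
    (r : ℝ) (hr : 0 < r) (xo : X) :
    ∑ y ∈ Sset W N r, ∏ n, W (ψ y n) (y n) =
      ∑ y ∈ Sset W N r, ∏ n, W xo (y n) := by
  obtain ⟨cls, hrow, hcolumn⟩ := hsym
  have key := sum_causal_eq W (fun y => Real.log (alphaU W y)⁻¹)
    (fun G => sum_mul_eq_of_row_perm W hrow fun y y' h => by
      rw [alphaU_eq_of_map_eq W (hcolumn y y' h)])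
    xo N (fun t => if (N : ℝ)⁻¹ * t ≤ r then 1 else 0) ψ hψ
  simpa only [Sset, Finset.sum_filter, mul_ite, mul_one, mul_zero] using key
end

section
/- Let W be a symmetric discrete memoryless channel and let P be a probability distribution on X with P(x) > 0 for all x ∈ X. Then the reverse dispersion V^r(P,W) = Σ_{x,y} P(x)W(y|x)[ln(W(y|x)/q_P(y)) − Σ_z (P(z)W(y|z)/q_P(y)) ln(W(y|z)/q_P(y))]² equals 0 if and only if W is singular, i.e., if and only if for every (x,y,z) ∈ X×Y×X with W(y|x)W(y|z) > 0 one has W(y|x) = W(y|z). -/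
open Real Finset

/-- A probability distribution on a finite alphabet. -/
def IsProbDist {X : Type} [Fintype X] (Q : X → ℝ) : Prop :=
  (∀ x, 0 ≤ Q x) ∧ ∑ x, Q x = 1

variable {X Y : Type} [Fintype X] [Fintype Y]

/-- The output distribution induced by `P`. -/
noncomputable def qP (W : X → Y → ℝ) (P : X → ℝ) (y : Y) : ℝ := ∑ x, P x * W x y

/-- The reverse dispersion `V^r(P, W)`. -/
noncomputable def Vrev (W : X → Y → ℝ) (P : X → ℝ) : ℝ :=
  ∑ x, ∑ y, P x * W x y *
    (Real.log (W x y / qP W P y) -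
      ∑ z, P z * W z y / qP W P y * Real.log (W z y / qP W P y)) ^ 2

theorem Vrev_eq_zero_iff (W : X → Y → ℝ) (hW : ∀ x y, 0 ≤ W x y) (P : X → ℝ)
    (hP : ∀ x, 0 < P x) :
    Vrev W P = 0 ↔ ∀ x y, 0 < W x y → Real.log (W x y / qP W P y) =
      ∑ z, P z * W z y / qP W P y * Real.log (W z y / qP W P y) := by
  have hterm : ∀ x y, 0 ≤ P x * W x y * (Real.log (W x y / qP W P y) -
      ∑ z, P z * W z y / qP W P y * Real.log (W z y / qP W P y)) ^ 2 := fun x y =>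
    mul_nonneg (mul_nonneg (hP x).le (hW x y)) (sq_nonneg _)
  rw [Vrev, Finset.sum_eq_zero_iff_of_nonneg fun x _ => Finset.sum_nonneg fun y _ => hterm x y]
  simp only [Finset.sum_eq_zero_iff_of_nonneg fun y _ => hterm _ y, Finset.mem_univ,
    true_imp_iff, mul_eq_zero, (hP _).ne', false_or, sq_eq_zero_iff, sub_eq_zero]
  refine forall₂_congr fun x y => ⟨fun h hpos => h.resolve_left hpos.ne', fun h => ?_⟩
  rcases (hW x y).eq_or_lt with h0 | h0
  · exact Or.inl h0.symm
  · exact Or.inr (h h0)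

theorem qP_pos {W : X → Y → ℝ} (hW : ∀ x y, 0 ≤ W x y) {P : X → ℝ} (hP : ∀ x, 0 < P x)
    {x : X} {y : Y} (h : 0 < W x y) : 0 < qP W P y :=
  Finset.sum_pos' (fun z _ => mul_nonneg (hP z).le (hW z y))
    ⟨x, Finset.mem_univ x, mul_pos (hP x) h⟩

/-- For a symmetric channel and a fully supported input distribution `P`, the reverse
dispersion `V^r(P, W)` vanishes iff the channel is singular. -/
theorem statement19 {X Y : Type} [Fintype X] [Fintype Y] [Nonempty X] [Nonempty Y]
    (W : X → Y → ℝ) (hW : IsDMC W) (hsym : GallagerSymmetric W)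
    (P : X → ℝ) (hP : IsProbDist P) (hfull : ∀ x, 0 < P x) :
    Vrev W P = 0 ↔
      ∀ x y z, 0 < W x y * W z y → W x y = W z y := by
  rw [Vrev_eq_zero_iff W hW.1 P hfull]
  constructor
  · intro h x y z hxz
    have hx : 0 < W x y := (hW.1 x y).lt_of_ne fun h0 => by simp [← h0] at hxz
    have hz : 0 < W z y := (hW.1 z y).lt_of_ne fun h0 => by simp [← h0] at hxz
    have hq := qP_pos hW.1 hfull hx
    have hlog := Real.log_injOn_pos (div_pos hx hq) (div_pos hz hq)
      ((h x y hx).trans (h z y hz).symm)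
    exact (div_left_inj' hq.ne').1 hlog
  · intro h x y hx
    have hq := qP_pos hW.1 hfull hx
    have hconst : ∀ z, P z * W z y / qP W P y * Real.log (W z y / qP W P y) =
        P z * W z y / qP W P y * Real.log (W x y / qP W P y) := by
      intro z
      rcases (hW.1 z y).eq_or_lt with h0 | h0
      · simp [← h0]
      · rw [h x y z (mul_pos hx h0)]
    rw [Finset.sum_congr rfl fun z _ => hconst z, ← Finset.sum_mul, ← Finset.sum_div, ← qP,
      div_self hq.ne', one_mul]
end
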